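/- arXiv:1409.0632 — 5 statements merged into one kernel-verified Lean document; each statement's English description precedes it below -/
import Mathlib

section
/- Let (τ_0, τ_1, τ_2) be a τ-model on a finite set X, let B ⊆ X be invariant under τ_1 and τ_2, and let (τ_0, τ_1', τ_2') be the partial dual relative to B. Then the subgroup of permutations of X generated by τ_0, τ_1, τ_2 and the subgroup generated by τ_0, τ_1', τ_2' have exactly the same orbits on X. In particular, if one of these subgroups acts transitively on X then so does the other (partial duality preserves connectedness of hypermaps). -/
attribute [local instance] Classical.propDecidable

/-- If every generator in `S` moves each point within its orbit under the group generated by `T`,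
then orbits of the group generated by `S` are contained in those of the group generated by `T`. -/
theorem orbit_closure_subset_of_forall_mem {G X : Type*} [Group G] [MulAction G X] {S T : Set G}
    (h : ∀ s ∈ S, ∀ y : X, s • y ∈ MulAction.orbit (Subgroup.closure T) y) (x : X) :
    MulAction.orbit (Subgroup.closure S) x ⊆ MulAction.orbit (Subgroup.closure T) x := by
  have key : ∀ g ∈ Subgroup.closure S, ∀ y : X,
      g • y ∈ MulAction.orbit (Subgroup.closure T) y := by
    intro g hg
    induction hg using Subgroup.closure_induction with
    | mem s hs => exact h s hs
    | one => intro y; simp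
    | mul a b _ _ ha hb =>
      intro y
      rw [mul_smul, ← MulAction.orbit_eq_iff.mpr (hb y)]
      exact ha (b • y)
    | inv a _ ha =>
      intro y
      rw [MulAction.mem_orbit_symm]
      simpa using ha (a⁻¹ • y)
  rintro _ ⟨g, rfl⟩
  exact key g g.2 x

/-- A generator moves each point within its orbit. -/
theorem smul_mem_orbit_closure {G X : Type*} [Group G] [MulAction G X] {T : Set G} {t : G}
    (ht : t ∈ T) (y : X) : t • y ∈ MulAction.orbit (Subgroup.closure T) y :=
  ⟨⟨t, Subgroup.subset_closure ht⟩, rfl⟩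

/-- Partial duality preserves the orbits of the group generated by the three involutions;
in particular it preserves connectedness of hypermaps. -/
theorem partialDual_same_orbits {X : Type*} [Fintype X]
    (τ0 τ1 τ2 τ1' τ2' : Equiv.Perm X)
    (h0 : τ0 * τ0 = 1) (h0' : ∀ x, τ0 x ≠ x)
    (h1 : τ1 * τ1 = 1) (h1' : ∀ x, τ1 x ≠ x)
    (h2 : τ2 * τ2 = 1) (h2' : ∀ x, τ2 x ≠ x)
    (B : Set X)
    (hB1 : ∀ x, x ∈ B ↔ τ1 x ∈ B) (hB2 : ∀ x, x ∈ B ↔ τ2 x ∈ B)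
    (hτ1' : ∀ x, τ1' x = if x ∈ B then τ2 x else τ1 x)
    (hτ2' : ∀ x, τ2' x = if x ∈ B then τ1 x else τ2 x) :
    ∀ x : X,
      MulAction.orbit (↥(Subgroup.closure ({τ0, τ1, τ2} : Set (Equiv.Perm X)))) x =
        MulAction.orbit (↥(Subgroup.closure ({τ0, τ1', τ2'} : Set (Equiv.Perm X)))) x := by
  intro x
  apply Set.Subset.antisymm
  · apply orbit_closure_subset_of_forall_mem
    have m0 := smul_mem_orbit_closure (X := X) (T := {τ0, τ1', τ2'}) (t := τ0) (by simp)
    have m1 := smul_mem_orbit_closure (X := X) (T := {τ0, τ1', τ2'}) (t := τ1') (by simp)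
    have m2 := smul_mem_orbit_closure (X := X) (T := {τ0, τ1', τ2'}) (t := τ2') (by simp)
    simp only [Equiv.Perm.smul_def] at m0 m1 m2 ⊢
    rintro s (rfl | rfl | rfl) y
    · exact m0 y
    · by_cases hy : y ∈ B
      · simpa only [hτ2', if_pos hy] using m2 y
      · simpa only [hτ1', if_neg hy] using m1 y
    · by_cases hy : y ∈ B
      · simpa only [hτ1', if_pos hy] using m1 y
      · simpa only [hτ2', if_neg hy] using m2 y
  · apply orbit_closure_subset_of_forall_mem
    have m0 := smul_mem_orbit_closure (X := X) (T := {τ0, τ1, τ2}) (t := τ0) (by simp)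
    have m1 := smul_mem_orbit_closure (X := X) (T := {τ0, τ1, τ2}) (t := τ1) (by simp)
    have m2 := smul_mem_orbit_closure (X := X) (T := {τ0, τ1, τ2}) (t := τ2) (by simp)
    simp only [Equiv.Perm.smul_def] at m0 m1 m2 ⊢
    rintro s (rfl | rfl | rfl) y
    · exact m0 y
    · rw [hτ1']
      split_ifs
      exacts [m2 y, m1 y]
    · rw [hτ2']
      split_ifs
      exacts [m1 y, m2 y]
end

section
/- Let (τ_0, τ_1, τ_2) be a τ-model on a finite nonempty set X such that the subgroup generated by τ_0, τ_1, τ_2 acts transitively on X (the hypermap is connected). Then the simple graph Γ on X, in which x and y are adjacent iff y ∈ {τ_0(x), τ_1(x), τ_2(x)}, is bipartite (admits a proper 2-coloring) if and only if the subgroup G generated by the products τ_2 ∘ τ_1, τ_0 ∘ τ_2, τ_1 ∘ τ_0 does not act transitively on X. That is, the hypermap corresponding to a [2]-colored graph is orientable if and only if the graph is bipartite. -/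
section InvolutionGenerators

variable {G : Type*} [Group G] {a b c : G}

/-- The subgroup of even words in three involutions contains every product of two of them. -/
theorem mul_mem_closure_products (ha : a * a = 1) (hb : b * b = 1) (hc : c * c = 1)
    {s t : G} (hs : s = a ∨ s = b ∨ s = c) (ht : t = a ∨ t = b ∨ t = c) :
    s * t ∈ Subgroup.closure ({c * b, a * c, b * a} : Set G) := by
  have ia : a⁻¹ = a := inv_eq_of_mul_eq_one_left ha
  have ib : b⁻¹ = b := inv_eq_of_mul_eq_one_left hb
  have ic : c⁻¹ = c := inv_eq_of_mul_eq_one_left hc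
  have hcb : c * b ∈ Subgroup.closure ({c * b, a * c, b * a} : Set G) :=
    Subgroup.subset_closure (by simp)
  have hac : a * c ∈ Subgroup.closure ({c * b, a * c, b * a} : Set G) :=
    Subgroup.subset_closure (by simp)
  have hba : b * a ∈ Subgroup.closure ({c * b, a * c, b * a} : Set G) :=
    Subgroup.subset_closure (by simp)
  have hbc := inv_mem hcb
  have hca := inv_mem hac
  have hab := inv_mem hba
  rw [mul_inv_rev, ib, ic] at hbc
  rw [mul_inv_rev, ia, ic] at hca
  rw [mul_inv_rev, ia, ib] at hab
  rcases hs with rfl | rfl | rfl <;> rcases ht with rfl | rfl | rfl <;>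
    first | assumption | simp only [ha, hb, hc, one_mem]

/-- Conjugation by the first involution preserves the subgroup of even words. -/
theorem conj_mem_closure_products (ha : a * a = 1) (hb : b * b = 1) (hc : c * c = 1)
    {g : G} (hg : g ∈ Subgroup.closure ({c * b, a * c, b * a} : Set G)) :
    a * g * a ∈ Subgroup.closure ({c * b, a * c, b * a} : Set G) := by
  have ia : a⁻¹ = a := inv_eq_of_mul_eq_one_left ha
  have key {s t : G} (hs : s = a ∨ s = b ∨ s = c) (ht : t = a ∨ t = b ∨ t = c) :
      a * (s * t) * a ∈ Subgroup.closure ({c * b, a * c, b * a} : Set G) := by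
    have h := mul_mem (mul_mem_closure_products ha hb hc (.inl rfl) hs)
      (mul_mem_closure_products ha hb hc ht (.inl rfl))
    simpa only [mul_assoc] using h
  induction hg using Subgroup.closure_induction with
  | mem x hx =>
    rcases hx with rfl | rfl | rfl <;> exact key (by simp) (by simp)
  | one => simp [ha, one_mem]
  | mul x y _ _ hx hy =>
    have h : a * (x * y) * a = a * x * a * (a * y * a) :=
      calc a * (x * y) * a = a * x * 1 * y * a := by group
        _ = a * x * a * (a * y * a) := by rw [← ha]; group
    exact h ▸ mul_mem hx hy
  | inv x _ hx =>
    have h := inv_mem hx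
    rwa [mul_inv_rev, mul_inv_rev, ia, ← mul_assoc] at h

/-- Every word in three involutions is even, or becomes even after multiplication by the first. -/
theorem mem_closure_products_or (ha : a * a = 1) (hb : b * b = 1) (hc : c * c = 1)
    {g : G} (hg : g ∈ Subgroup.closure ({a, b, c} : Set G)) :
    g ∈ Subgroup.closure ({c * b, a * c, b * a} : Set G) ∨
      a * g ∈ Subgroup.closure ({c * b, a * c, b * a} : Set G) := by
  have step {s y : G} (hs : s = a ∨ s = b ∨ s = c)
      (h : y ∈ Subgroup.closure ({c * b, a * c, b * a} : Set G) ∨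
        a * y ∈ Subgroup.closure ({c * b, a * c, b * a} : Set G)) :
      s * y ∈ Subgroup.closure ({c * b, a * c, b * a} : Set G) ∨
        a * (s * y) ∈ Subgroup.closure ({c * b, a * c, b * a} : Set G) := by
    rcases h with h | h
    · exact .inr (mul_assoc a s y ▸ mul_mem (mul_mem_closure_products ha hb hc (.inl rfl) hs) h)
    · have := mul_mem (mul_mem_closure_products ha hb hc hs (.inl rfl)) h
      rw [mul_assoc, ← mul_assoc a a, ha, one_mul] at this
      exact .inl this
  induction hg using Subgroup.closure_induction_left with
  | one => exact .inl (one_mem _)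
  | mul_left x hx y _ ih => exact step hx ih
  | inv_mul_cancel x hx y _ ih =>
    have ix : x⁻¹ = x := by
      apply inv_eq_of_mul_eq_one_left
      rcases hx with rfl | rfl | rfl <;> assumption
    exact ix.symm ▸ step hx ih

end InvolutionGenerators


/-- A connected hypermap (τ-model) is orientable — i.e. its [2]-colored graph is
bipartite — if and only if the subgroup of even words in the involutions fails to act
transitively on the set of flags. -/
theorem orientable_iff_bipartite {X : Type*} [Fintype X] [Nonempty X]
    (τ0 τ1 τ2 : Equiv.Perm X)
    (h0 : τ0 * τ0 = 1) (h0' : ∀ x, τ0 x ≠ x)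
    (h1 : τ1 * τ1 = 1) (h1' : ∀ x, τ1 x ≠ x)
    (h2 : τ2 * τ2 = 1) (h2' : ∀ x, τ2 x ≠ x)
    (hconn : ∀ x y : X,
      ∃ g ∈ Subgroup.closure ({τ0, τ1, τ2} : Set (Equiv.Perm X)), g x = y) :
    (∃ f : X → Bool, ∀ x y : X,
        (y = τ0 x ∨ y = τ1 x ∨ y = τ2 x) → f x ≠ f y) ↔
      ¬ (∀ x y : X,
        ∃ g ∈ Subgroup.closure ({τ2 * τ1, τ0 * τ2, τ1 * τ0} : Set (Equiv.Perm X)),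
          g x = y) := by
  classical
  set E := Subgroup.closure ({τ2 * τ1, τ0 * τ2, τ1 * τ0} : Set (Equiv.Perm X))
  constructor
  · rintro ⟨f, hf⟩ htrans
    have even {s t : Equiv.Perm X} (hs : s = τ0 ∨ s = τ1 ∨ s = τ2)
        (ht : t = τ0 ∨ t = τ1 ∨ t = τ2) (x : X) : f ((s * t) x) = f x := by
      have h₁ : f x ≠ f (t x) := hf _ _ (by rcases ht with rfl | rfl | rfl <;> simp)
      have h₂ : f (t x) ≠ f (s (t x)) := hf _ _ (by rcases hs with rfl | rfl | rfl <;> simp)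
      rw [Equiv.Perm.mul_apply]
      revert h₁ h₂
      cases f x <;> cases f (t x) <;> cases f (s (t x)) <;> simp
    have hinv : ∀ g ∈ E, ∀ x, f (g x) = f x := by
      intro g hg
      induction hg using Subgroup.closure_induction with
      | mem g hg =>
        rcases hg with rfl | rfl | rfl <;> exact even (by simp) (by simp)
      | one => simp
      | mul g k _ _ hg hk => intro x; rw [Equiv.Perm.mul_apply, hg, hk]
      | inv g _ hg => intro x; simpa using (hg (g⁻¹ x)).symm
    obtain ⟨x⟩ := ‹Nonempty X›
    obtain ⟨g, hg, hgx⟩ := htrans x (τ0 x)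
    exact hf x (τ0 x) (.inl rfl) (by rw [← hgx, hinv g hg])
  · intro hnot
    push Not at hnot
    obtain ⟨a, b, hab⟩ := hnot
    have hodd {g : Equiv.Perm X} (hg : τ0 * g ∈ E) : g a ≠ a := by
      intro hga
      obtain ⟨w, hw, hwb⟩ := hconn a b
      rcases mem_closure_products_or h0 h1 h2 hw with hw | hw
      · exact hab w hw hwb
      · have h := mul_mem (conj_mem_closure_products h0 h1 h2 hw) hg
        have heq : τ0 * (τ0 * w) * τ0 * (τ0 * g) = w * g :=
          calc τ0 * (τ0 * w) * τ0 * (τ0 * g) = (τ0 * τ0) * w * (τ0 * τ0) * g := by group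
            _ = w * g := by rw [h0]; group
        rw [heq] at h
        exact hab _ h (by rw [Equiv.Perm.mul_apply, hga, hwb])
    have hstep {t : Equiv.Perm X} (ht : t = τ0 ∨ t = τ1 ∨ t = τ2) (x : X) :
        ¬ ((∃ g ∈ E, g a = x) ↔ ∃ g ∈ E, g a = t x) := by
      intro hiff
      by_cases hx : ∃ g ∈ E, g a = x
      · obtain ⟨k, hk, hka⟩ := hiff.1 hx
        obtain ⟨g, hg, rfl⟩ := hx
        have hmem : τ0 * (k⁻¹ * (t * g)) ∈ E := by
          have h := mul_mem (conj_mem_closure_products h0 h1 h2 (inv_mem hk))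
            (mul_mem (mul_mem_closure_products h0 h1 h2 (.inl rfl) ht) hg)
          have heq : τ0 * k⁻¹ * τ0 * (τ0 * t * g) = τ0 * (k⁻¹ * (t * g)) :=
            calc τ0 * k⁻¹ * τ0 * (τ0 * t * g) = τ0 * k⁻¹ * (τ0 * τ0) * t * g := by group
              _ = τ0 * (k⁻¹ * (t * g)) := by rw [h0]; group
          rwa [heq] at h
        apply hodd hmem
        rw [Equiv.Perm.mul_apply, Equiv.Perm.mul_apply, ← hka]
        simp
      · obtain ⟨w, hw, rfl⟩ := hconn a x
        rcases mem_closure_products_or h0 h1 h2 hw with hw | hw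
        · exact hx ⟨w, hw, rfl⟩
        · have h := mul_mem (mul_mem_closure_products h0 h1 h2 ht (.inl rfl)) hw
          rw [mul_assoc, ← mul_assoc τ0 τ0, h0, one_mul] at h
          exact hx (hiff.2 ⟨t * w, h, rfl⟩)
    refine ⟨fun x => decide (∃ g ∈ E, g a = x), ?_⟩
    rintro x y (rfl | rfl | rfl) h <;>
      exact hstep (by simp) x (decide_eq_decide.1 h)
end

section
/- Let (σ_V, σ_E, σ_F) be a σ-model on a finite nonempty set H with n := |H|, such that the subgroup generated by σ_V and σ_E acts transitively on H (the hypermap is connected). Let c_V, c_E, c_F denote the numbers of cycles (orbits) of σ_V, σ_E, σ_F on H respectively. Then the Euler characteristic χ := c_V + c_E + c_F − n satisfies χ ≤ 2 and χ ≡ 0 (mod 2); i.e. c_V + c_E + c_F ≤ n + 2 and c_V + c_E + c_F ≡ n (mod 2), so that χ = 2 − 2g for a nonnegative integer g (the genus). -/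
open Equiv Equiv.Perm

/-- The setoid obtained from `r` by merging the class of `y` into the class of `x`. -/
noncomputable def Setoid.merge {H : Type*} (r : Setoid H) (x y : H) : Setoid H :=
  open Classical in Setoid.ker fun h =>
    if (⟦h⟧ : Quotient r) = ⟦y⟧ then (⟦x⟧ : Quotient r) else ⟦h⟧

namespace Setoid

variable {H : Type*} {r t : Setoid H} {x y : H}

open Classical in
theorem merge_apply {a b : H} : r.merge x y a b ↔
    (if (⟦a⟧ : Quotient r) = ⟦y⟧ then (⟦x⟧ : Quotient r) else ⟦a⟧) =
      if (⟦b⟧ : Quotient r) = ⟦y⟧ then ⟦x⟧ else ⟦b⟧ :=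
  Iff.rfl

theorem merge_le_iff : r.merge x y ≤ t ↔ r ≤ t ∧ t x y := by
  constructor
  · intro h
    refine ⟨fun a b hab => h ?_, h ?_⟩
    · have : (⟦a⟧ : Quotient r) = ⟦b⟧ := Quotient.sound hab
      rw [merge_apply, this]
    · rw [merge_apply, if_pos rfl]
      split_ifs <;> rfl
  · rintro ⟨hr, hxy⟩ a b hab
    replace hab := merge_apply.1 hab
    have hyx := t.symm hxy
    split_ifs at hab with ha hb hb
    · exact t.trans (hr (Quotient.exact ha)) (t.symm (hr (Quotient.exact hb)))
    · exact t.trans (hr (Quotient.exact ha)) (t.trans hyx (hr (Quotient.exact hab)))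
    · exact t.trans (hr (Quotient.exact hab)) (t.trans hxy (t.symm (hr (Quotient.exact hb))))
    · exact hr (Quotient.exact hab)

theorem merge_eq_self (h : r x y) : r.merge x y = r :=
  le_antisymm (merge_le_iff.2 ⟨le_rfl, h⟩) (merge_le_iff.1 le_rfl).1

theorem merge_eq_merge {s : Setoid H} (h₁ : r ≤ s.merge x y) (h₂ : s ≤ r.merge x y) :
    r.merge x y = s.merge x y :=
  le_antisymm (merge_le_iff.2 ⟨h₁, (merge_le_iff.1 le_rfl).2⟩)
    (merge_le_iff.2 ⟨h₂, (merge_le_iff.1 le_rfl).2⟩)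

theorem card_quotient_merge [Finite H] (h : ¬ r x y) :
    Nat.card (Quotient (r.merge x y)) + 1 = Nat.card (Quotient r) := by
  classical
  have hxy : (⟦x⟧ : Quotient r) ≠ ⟦y⟧ := fun e => h (Quotient.exact e)
  have hrange : Set.range (fun h : H => if (⟦h⟧ : Quotient r) = ⟦y⟧ then (⟦x⟧ : Quotient r)
      else ⟦h⟧) = {(⟦y⟧ : Quotient r)}ᶜ := by
    ext q
    induction q using Quotient.inductionOn with | _ q
    constructor
    · rintro ⟨a, ha⟩
      simp only at ha
      rw [← ha]
      split_ifs with hay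
      · exact hxy
      · exact hay
    · intro hq
      exact ⟨q, if_neg hq⟩
  have hcard : Nat.card (Quotient (r.merge x y)) = ({(⟦y⟧ : Quotient r)}ᶜ : Set _).ncard := by
    rw [← hrange, ← Nat.card_coe_set_eq]
    exact Nat.card_congr (Setoid.quotientKerEquivRange _)
  have := Set.ncard_add_ncard_compl {(⟦y⟧ : Quotient r)}
  rw [Set.ncard_singleton] at this
  omega

theorem card_quotient_le_card_quotient_merge_add_one [Finite H] :
    Nat.card (Quotient r) ≤ Nat.card (Quotient (r.merge x y)) + 1 := by
  by_cases h : r x y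
  · rw [merge_eq_self h]
    omega
  · exact (card_quotient_merge h).ge

theorem card_quotient_merge_le [Finite H] :
    Nat.card (Quotient (r.merge x y)) ≤ Nat.card (Quotient r) := by
  by_cases h : r x y
  · rw [merge_eq_self h]
  · have := card_quotient_merge h
    omega

end Setoid

namespace Equiv.Perm

/-- The partition of `H` into the cycles of `σ`, fixed points included. -/
abbrev cycleSetoid {H : Type*} (σ : Perm H) : Setoid H :=
  MulAction.orbitRel (Subgroup.zpowers σ) H

/-- The number of cycles of `σ`, fixed points included. -/
noncomputable abbrev numCycles {H : Type*} (σ : Perm H) : ℕ :=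
  Nat.card (Quotient σ.cycleSetoid)

variable {H : Type*}

theorem le_of_mem_closure {s : Set (Perm H)} {t : Setoid H} (hs : ∀ g ∈ s, ∀ x, t x (g x))
    {g : Perm H} (hg : g ∈ Subgroup.closure s) (x : H) : t x (g x) := by
  induction hg using Subgroup.closure_induction generalizing x with
  | mem g hg => exact hs g hg x
  | one => exact t.refl x
  | mul f g _ _ hf hg => exact t.trans (hg x) (hf (g x))
  | inv g _ hg =>
    have := hg (g⁻¹ x)
    rw [← mul_apply, mul_inv_cancel, one_apply] at this
    exact t.symm this

theorem cycleSetoid_apply (σ : Perm H) (x : H) : σ.cycleSetoid x (σ x) :=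
  σ.cycleSetoid.symm ⟨⟨σ, Subgroup.mem_zpowers σ⟩, rfl⟩

theorem cycleSetoid_le_iff {σ : Perm H} {t : Setoid H} :
    σ.cycleSetoid ≤ t ↔ ∀ x, t x (σ x) := by
  refine ⟨fun h x => h (σ.cycleSetoid_apply x), fun h a b hab => ?_⟩
  obtain ⟨⟨g, hg⟩, rfl⟩ := hab
  rw [Subgroup.zpowers_eq_closure] at hg
  exact t.symm (le_of_mem_closure (by simpa using h) hg b)

theorem cycleSetoid_mul_le {f g : Perm H} {t : Setoid H} (hf : f.cycleSetoid ≤ t)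
    (hg : g.cycleSetoid ≤ t) : (f * g).cycleSetoid ≤ t :=
  cycleSetoid_le_iff.2 fun x =>
    t.trans (cycleSetoid_le_iff.1 hg x) (cycleSetoid_le_iff.1 hf (g x))

theorem cycleSetoid_one : (1 : Perm H).cycleSetoid = ⊥ :=
  le_bot_iff.1 (cycleSetoid_le_iff.2 fun _ => rfl)

theorem numCycles_one : (1 : Perm H).numCycles = Nat.card H := by
  rw [numCycles, cycleSetoid_one]
  exact Nat.card_congr Setoid.quotientBotEquiv

theorem not_cycleSetoid_of_apply_eq_self {σ : Perm H} {x y : H} (hx : σ x = x) (hxy : x ≠ y) :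
    ¬ σ.cycleSetoid x y := by
  intro h
  have hle : σ.cycleSetoid ≤ Setoid.ker (fun z => z = x) := by
    refine cycleSetoid_le_iff.2 fun z => ?_
    rw [Setoid.ker_def, eq_iff_iff]
    exact ⟨fun hz => by rw [hz, hx], fun hz => σ.injective (hz.trans hx.symm)⟩
  have := hle h
  rw [Setoid.ker_def, eq_iff_iff] at this
  exact hxy (this.1 rfl).symm

variable [DecidableEq H]

theorem cycleSetoid_swap_mul_le (σ : Perm H) (x y : H) :
    (swap x y * σ).cycleSetoid ≤ σ.cycleSetoid.merge x y := by
  obtain ⟨h₁, h₂⟩ := Setoid.merge_le_iff.1 (le_refl (σ.cycleSetoid.merge x y))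
  refine cycleSetoid_mul_le (cycleSetoid_le_iff.2 fun z => ?_) h₁
  rw [swap_apply_def]
  split_ifs with hx hy
  · exact (by rwa [hx])
  · rw [hy]
    exact Setoid.symm' _ h₂
  · exact Setoid.refl' _ z

theorem merge_cycleSetoid_swap_mul (σ : Perm H) (x y : H) :
    (swap x y * σ).cycleSetoid.merge x y = σ.cycleSetoid.merge x y := by
  refine Setoid.merge_eq_merge (cycleSetoid_swap_mul_le σ x y) ?_
  simpa using cycleSetoid_swap_mul_le (swap x y * σ) x y

theorem cycleSetoid_swap_mul_of_apply_eq_self {σ : Perm H} {x y : H} (hx : σ x = x) :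
    (swap x y * σ).cycleSetoid = σ.cycleSetoid.merge x y := by
  rw [← merge_cycleSetoid_swap_mul, Setoid.merge_eq_self]
  simpa [hx] using cycleSetoid_apply (swap x y * σ) x

variable [Fintype H]

/-- Every permutation is built from the identity by repeatedly inserting a fixed point
into a cycle. -/
theorem fixed_swap_induction {P : Perm H → Prop} (one : P 1)
    (swap_mul : ∀ (f : Perm H) (x y : H), f x = x → x ≠ y → P f → P (swap x y * f))
    (f : Perm H) : P f := by
  induction hn : f.support.card using Nat.strong_induction_on generalizing f with
  | _ n ih =>
    by_cases hf : f = 1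
    · exact hf ▸ one
    · obtain ⟨x, hx⟩ : ∃ x, f x ≠ x := by
        by_contra! h
        exact hf (Perm.ext h)
      have := swap_mul (swap x (f x) * f) x (f x) (by simp) (Ne.symm hx)
        (ih _ (hn ▸ card_support_swap_mul hx) _ rfl)
      simpa using this

theorem numCycles_swap_mul_of_apply_eq_self {σ : Perm H} {x y : H} (hx : σ x = x)
    (hxy : x ≠ y) : (swap x y * σ).numCycles + 1 = σ.numCycles := by
  rw [numCycles, cycleSetoid_swap_mul_of_apply_eq_self hx]
  exact Setoid.card_quotient_merge (not_cycleSetoid_of_apply_eq_self hx hxy)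

theorem sign_eq_neg_one_pow_numCycles (σ : Perm H) :
    sign σ = (-1) ^ (Nat.card H + σ.numCycles) := by
  induction σ using fixed_swap_induction with
  | one => simp [numCycles_one]
  | swap_mul f x y hx hxy ih =>
    rw [sign_mul, sign_swap hxy, ih, ← numCycles_swap_mul_of_apply_eq_self hx hxy, ← add_assoc,
      pow_succ]
    simp

theorem numCycles_swap_mul_le (σ : Perm H) (x y : H) :
    (swap x y * σ).numCycles ≤ σ.numCycles + 1 := by
  refine (Setoid.card_quotient_le_card_quotient_merge_add_one (x := x) (y := y)).trans ?_
  rw [merge_cycleSetoid_swap_mul]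
  exact Nat.succ_le_succ Setoid.card_quotient_merge_le

theorem numCycles_swap_mul_of_not_cycleSetoid {σ : Perm H} {x y : H}
    (h : ¬ σ.cycleSetoid x y) : (swap x y * σ).numCycles + 1 = σ.numCycles := by
  have hxy : x ≠ y := by
    rintro rfl
    exact h (σ.cycleSetoid.refl x)
  have hcard := Setoid.card_quotient_merge h
  by_cases hτ : (swap x y * σ).cycleSetoid x y
  · rwa [← merge_cycleSetoid_swap_mul, Setoid.merge_eq_self hτ] at hcard
  · have heq : (swap x y * σ).numCycles = σ.numCycles := by
      rw [numCycles, numCycles, ← hcard, ← merge_cycleSetoid_swap_mul,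
        Setoid.card_quotient_merge hτ]
    have hsign := Perm.sign_mul (swap x y) σ
    rw [sign_swap hxy, sign_eq_neg_one_pow_numCycles, heq, ← sign_eq_neg_one_pow_numCycles] at hsign
    rcases Int.units_eq_one_or (sign σ) with hs | hs <;> simp [hs] at hsign

theorem numCycles_add_le (a b : Perm H) :
    a.numCycles + b.numCycles + (b * a).numCycles ≤
      Nat.card H + 2 * Nat.card (Quotient (a.cycleSetoid ⊔ b.cycleSetoid)) := by
  induction b using fixed_swap_induction with
  | one =>
    rw [cycleSetoid_one, sup_bot_eq, one_mul, numCycles_one]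
    lia
  | swap_mul b x y hx hxy ih =>
    have hb := numCycles_swap_mul_of_apply_eq_self hx hxy
    have hjoin : a.cycleSetoid ⊔ (swap x y * b).cycleSetoid =
        (a.cycleSetoid ⊔ b.cycleSetoid).merge x y := by
      rw [cycleSetoid_swap_mul_of_apply_eq_self hx]
      refine eq_of_forall_ge_iff fun t => ?_
      simp only [sup_le_iff, Setoid.merge_le_iff, and_assoc]
    rw [hjoin, mul_assoc]
    by_cases h : (a.cycleSetoid ⊔ b.cycleSetoid) x y
    · rw [Setoid.merge_eq_self h]
      have := numCycles_swap_mul_le (b * a) x y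
      lia
    · have hba : ¬ (b * a).cycleSetoid x y :=
        fun h' => h (cycleSetoid_mul_le le_sup_right le_sup_left h')
      have := numCycles_swap_mul_of_not_cycleSetoid hba
      have := Setoid.card_quotient_merge h
      lia

end Equiv.Perm

/-- Euler characteristic of a connected oriented hypermap: `χ = c_V + c_E + c_F − n`
satisfies `χ ≤ 2` and `χ ≡ 0 (mod 2)`, i.e. `χ = 2 − 2g` for a nonnegative integer `g`
(the genus). -/
theorem euler_characteristic_bound {H : Type*} [Fintype H] [Nonempty H]
    (σV σE σF : Equiv.Perm H) (hmodel : σF * σE * σV = 1)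
    (hconn : ∀ x y : H,
      ∃ g ∈ Subgroup.closure ({σV, σE} : Set (Equiv.Perm H)), g x = y) :
    Nat.card (MulAction.orbitRel.Quotient (↥(Subgroup.zpowers σV)) H) +
        Nat.card (MulAction.orbitRel.Quotient (↥(Subgroup.zpowers σE)) H) +
        Nat.card (MulAction.orbitRel.Quotient (↥(Subgroup.zpowers σF)) H) ≤
      Nat.card H + 2 ∧
    ∃ g : ℕ,
      Nat.card (MulAction.orbitRel.Quotient (↥(Subgroup.zpowers σV)) H) +
          Nat.card (MulAction.orbitRel.Quotient (↥(Subgroup.zpowers σE)) H) +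
          Nat.card (MulAction.orbitRel.Quotient (↥(Subgroup.zpowers σF)) H) + 2 * g =
        Nat.card H + 2 := by
  classical
  have hF : σF = (σE * σV)⁻¹ := eq_inv_of_mul_eq_one_left (by rwa [← mul_assoc])
  have hinv : σF.numCycles = (σE * σV).numCycles := by
    rw [hF, numCycles, cycleSetoid, Subgroup.zpowers_inv]
  have htop : σV.cycleSetoid ⊔ σE.cycleSetoid = ⊤ := by
    refine top_le_iff.1 fun x y _ => ?_
    obtain ⟨g, hg, rfl⟩ := hconn x y
    refine le_of_mem_closure ?_ hg x
    rintro f (rfl | rfl)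
    · exact cycleSetoid_le_iff.1 le_sup_left
    · exact cycleSetoid_le_iff.1 le_sup_right
  have hle : σV.numCycles + σE.numCycles + σF.numCycles ≤ Nat.card H + 2 := by
    have := numCycles_add_le σV σE
    have hcard : Nat.card (Quotient (⊤ : Setoid H)) = 1 :=
      Nat.card_eq_one_iff_unique.2 ⟨Quotient.subsingleton_iff.2 rfl, ‹Nonempty H›.map (Quotient.mk _)⟩
    rwa [htop, hcard, ← hinv] at this
  have heven : Even (Nat.card H + σV.numCycles + σE.numCycles + σF.numCycles) := by
    have h := congrArg sign hmodel
    rw [Perm.sign_mul, Perm.sign_mul, Perm.sign_one, sign_eq_neg_one_pow_numCycles,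
      sign_eq_neg_one_pow_numCycles, sign_eq_neg_one_pow_numCycles, ← pow_add, ← pow_add,
      neg_one_pow_eq_one_iff_even (by decide)] at h
    grind
  refine ⟨hle, (Nat.card H + 2 - (σV.numCycles + σE.numCycles + σF.numCycles)) / 2, ?_⟩
  change σV.numCycles + σE.numCycles + σF.numCycles + _ = _
  obtain ⟨k, hk⟩ := heven
  lia
end

section
/- Let (σ_V, σ_E, σ_F) be a σ-model on a finite set H and let (τ_0, τ_1, τ_2) be the associated τ-model on X := H × Bool. Then: (1) for each i ∈ H, the orbit of (i, true) under the subgroup generated by τ_1 and τ_2 equals C × Bool, where C is the orbit of i under σ_V; hence the number of orbits of ⟨τ_1, τ_2⟩ on X equals the number of cycles of σ_V (the vertices); (2) for each i ∈ H, the orbit of (i, true) under ⟨τ_0, τ_2⟩ equals D × Bool, where D is the orbit of i under σ_E; hence the number of orbits of ⟨τ_0, τ_2⟩ equals the number of cycles of σ_E (the hyperedges); (3) the number of orbits of ⟨τ_0, τ_1⟩ on X equals the number of cycles of σ_F (the faces). -/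
/-- `τ₂(i, ε) = (i, ¬ε)`. -/
def tau2fun (H : Type*) : H × Bool → H × Bool := fun p => (p.1, !p.2)

/-- `τ₁(i, +) = (σ_V i, −)`, `τ₁(i, −) = (σ_V⁻¹ i, +)`. -/
def tau1fun {H : Type*} (σV : Equiv.Perm H) : H × Bool → H × Bool
  | (i, true) => (σV i, false)
  | (i, false) => (σV.symm i, true)

/-- `τ₀(i, +) = (σ_E⁻¹ i, −)`, `τ₀(i, −) = (σ_E i, +)`. -/
def tau0fun {H : Type*} (σE : Equiv.Perm H) : H × Bool → H × Bool
  | (i, true) => (σE.symm i, false)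
  | (i, false) => (σE i, true)

theorem tau2fun_invol (H : Type*) : Function.Involutive (tau2fun H) := by
  intro p; simp [tau2fun]

theorem tau1fun_invol {H : Type*} (σV : Equiv.Perm H) :
    Function.Involutive (tau1fun σV) := by
  rintro ⟨i, b⟩; cases b <;> simp [tau1fun]

theorem tau0fun_invol {H : Type*} (σE : Equiv.Perm H) :
    Function.Involutive (tau0fun σE) := by
  rintro ⟨i, b⟩; cases b <;> simp [tau0fun]

/-- `τ₂` as a permutation of `H × Bool`. -/
def tau2perm (H : Type*) : Equiv.Perm (H × Bool) :=
  Function.Involutive.toPerm _ (tau2fun_invol H)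

/-- `τ₁` as a permutation of `H × Bool`. -/
def tau1perm {H : Type*} (σV : Equiv.Perm H) : Equiv.Perm (H × Bool) :=
  Function.Involutive.toPerm _ (tau1fun_invol σV)

/-- `τ₀` as a permutation of `H × Bool`. -/
def tau0perm {H : Type*} (σE : Equiv.Perm H) : Equiv.Perm (H × Bool) :=
  Function.Involutive.toPerm _ (tau0fun_invol σE)

/-- A map that carries each generator step into a relation carries orbits of the generated
subgroup into that relation. -/
theorem rel_of_orbitRel_closure {X Y : Type*} {S : Set (Equiv.Perm X)} (r : Setoid Y) (f : X → Y)
    (hS : ∀ g ∈ S, ∀ x, r (f (g x)) (f x)) {x y : X}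
    (h : MulAction.orbitRel (Subgroup.closure S) X x y) : r (f x) (f y) := by
  obtain ⟨⟨g, hg⟩, rfl⟩ := h
  change r (f (g y)) (f y)
  induction hg using Subgroup.closure_induction generalizing y with
  | mem g hg => exact hS g hg y
  | one => exact r.refl _
  | mul a b _ _ iha ihb => exact r.trans (iha (y := b y)) ihb
  | inv a _ ih => simpa using r.symm (ih (y := a⁻¹ y))

theorem orbitRel_closure_apply {X : Type*} {S : Set (Equiv.Perm X)} {g : Equiv.Perm X}
    (hg : g ∈ S) (x : X) : MulAction.orbitRel (Subgroup.closure S) X (g x) x :=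
  ⟨⟨g, Subgroup.subset_closure hg⟩, rfl⟩

theorem orbitRel_zpowers_apply {H : Type*} (σ : Equiv.Perm H) (i : H) :
    MulAction.orbitRel (Subgroup.zpowers σ) H (σ i) i :=
  ⟨⟨σ, Subgroup.mem_zpowers σ⟩, rfl⟩

theorem rel_of_orbitRel_zpowers {H Y : Type*} {σ : Equiv.Perm H} (r : Setoid Y) (f : H → Y)
    (hσ : ∀ i, r (f (σ i)) (f i)) {i j : H}
    (h : MulAction.orbitRel (Subgroup.zpowers σ) H i j) : r (f i) (f j) := by
  rw [Subgroup.zpowers_eq_closure] at h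
  exact rel_of_orbitRel_closure r f (by simpa using hσ) h

/-- Mutually inverse (up to orbits) maps that respect the generators identify the orbits of
`⟨S⟩` with the cycles of `σ`. -/
theorem card_orbits_closure_eq_zpowers {X H : Type*} {S : Set (Equiv.Perm X)} {σ : Equiv.Perm H}
    (p : X → H) (s : H → X)
    (hp : ∀ g ∈ S, ∀ x, MulAction.orbitRel (Subgroup.zpowers σ) H (p (g x)) (p x))
    (hs : ∀ i, MulAction.orbitRel (Subgroup.closure S) X (s (σ i)) (s i))
    (hps : ∀ i, p (s i) = i)
    (hsp : ∀ x, MulAction.orbitRel (Subgroup.closure S) X (s (p x)) x) :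
    Nat.card (MulAction.orbitRel.Quotient (Subgroup.closure S) X) =
      Nat.card (MulAction.orbitRel.Quotient (Subgroup.zpowers σ) H) :=
  Nat.card_congr
    { toFun := Quotient.map p fun _ _ h => rel_of_orbitRel_closure _ p hp h
      invFun := Quotient.map s fun _ _ h => rel_of_orbitRel_zpowers _ s hs h
      left_inv := by
        rintro ⟨x⟩
        exact Quotient.sound (hsp x)
      right_inv := by
        rintro ⟨i⟩
        exact congrArg _ (hps i) }

/-- If `τ` covers steps of `σ` on first coordinates, the orbits of `⟨τ, τ₂⟩` are the doubled
cycles of `σ`. -/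
theorem doubled_orbits {H : Type*} (σ : Equiv.Perm H) (τ : Equiv.Perm (H × Bool))
    (hτ : ∀ x, MulAction.orbitRel (Subgroup.zpowers σ) H (τ x).1 x.1)
    (hσ : ∀ i, ∃ ε, τ (i, ε) = (σ i, !ε)) :
    (∀ i : H, MulAction.orbit (Subgroup.closure {τ, tau2perm H}) ((i, true) : H × Bool) =
        MulAction.orbit (Subgroup.zpowers σ) i ×ˢ (Set.univ : Set Bool)) ∧
      Nat.card (MulAction.orbitRel.Quotient (Subgroup.closure {τ, tau2perm H}) (H × Bool)) =
        Nat.card (MulAction.orbitRel.Quotient (Subgroup.zpowers σ) H) := by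
  let r := MulAction.orbitRel (Subgroup.closure {τ, tau2perm H}) (H × Bool)
  have hp : ∀ g ∈ ({τ, tau2perm H} : Set (Equiv.Perm (H × Bool))), ∀ x,
      MulAction.orbitRel (Subgroup.zpowers σ) H (g x).1 x.1 := by
    rintro g (rfl | rfl) x
    · exact hτ x
    · exact (MulAction.orbitRel _ H).refl _
  have hflip : ∀ i ε, r (i, !ε) (i, ε) := fun i ε =>
    orbitRel_closure_apply (g := tau2perm H) (by simp) (i, ε)
  have hbool : ∀ i ε δ, r (i, ε) (i, δ) := by
    intro i ε δ
    cases ε <;> cases δ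
    exacts [r.refl _, hflip i true, hflip i false, r.refl _]
  have hs : ∀ i, r (σ i, true) (i, true) := by
    intro i
    obtain ⟨ε, hε⟩ := hσ i
    have h : r (τ (i, ε)) (i, ε) := orbitRel_closure_apply (by simp) _
    rw [hε] at h
    exact r.trans (hbool _ _ _) (r.trans h (hbool _ _ _))
  refine ⟨fun i => ?_, card_orbits_closure_eq_zpowers Prod.fst (fun i => (i, true)) hp hs
    (fun _ => rfl) fun x => hbool _ _ _⟩
  ext ⟨j, ε⟩
  simp only [Set.mem_prod, Set.mem_univ, and_true]
  exact ⟨fun h => rel_of_orbitRel_closure _ Prod.fst hp h,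
    fun h => r.trans (hbool j ε true) (rel_of_orbitRel_zpowers r (fun i => (i, true)) hs h)⟩

theorem card_face_orbits {H : Type*} (σV σE σF : Equiv.Perm H) (hmodel : σF * σE * σV = 1) :
    Nat.card (MulAction.orbitRel.Quotient
        (Subgroup.closure {tau0perm σE, tau1perm σV}) (H × Bool)) =
      Nat.card (MulAction.orbitRel.Quotient (Subgroup.zpowers σF) H) := by
  have hF : ∀ i, σF (σE (σV i)) = i := fun i => DFunLike.congr_fun hmodel i
  have hF' : ∀ i, σV.symm (σE.symm i) = σF i := by
    intro i
    simpa using (hF (σV.symm (σE.symm i))).symm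
  let r := MulAction.orbitRel (Subgroup.closure {tau0perm σE, tau1perm σV}) (H × Bool)
  let q := MulAction.orbitRel (Subgroup.zpowers σF) H
  have h0 : ∀ x, r (tau0perm σE x) x := orbitRel_closure_apply (by simp)
  have h1 : ∀ x, r (tau1perm σV x) x := orbitRel_closure_apply (by simp)
  refine card_orbits_closure_eq_zpowers (fun x => if x.2 then x.1 else σE x.1)
    (fun i => (i, true)) ?_ (fun i => ?_) (fun _ => rfl) ?_
  · rintro g (rfl | rfl) ⟨i, _ | _⟩
    · exact q.refl _
    · exact (σE.apply_symm_apply i).symm ▸ q.refl i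
    · have h := orbitRel_zpowers_apply σF (σE i)
      rw [← hF', σE.symm_apply_apply] at h
      exact h
    · have h := orbitRel_zpowers_apply σF (σE (σV i))
      rw [hF] at h
      exact q.symm h
  · have h := r.trans (h1 (tau0perm σE (i, true))) (h0 (i, true))
    rw [← hF']
    exact h
  · rintro ⟨i, _ | _⟩
    · exact h0 (i, false)
    · exact r.refl _

/-- Vertices, hyperedges and faces of the τ-model associated to a σ-model: orbits of
`⟨τ₁, τ₂⟩` are the doubled cycles of `σ_V`, orbits of `⟨τ₀, τ₂⟩` are the doubled cycles
of `σ_E`, and the number of orbits of `⟨τ₀, τ₁⟩` equals the number of cycles of `σ_F`. -/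
theorem tau_model_orbits {H : Type*} [Fintype H]
    (σV σE σF : Equiv.Perm H) (hmodel : σF * σE * σV = 1) :
    (∀ i : H,
      MulAction.orbit
          (↥(Subgroup.closure ({tau1perm σV, tau2perm H} : Set (Equiv.Perm (H × Bool)))))
          ((i, true) : H × Bool) =
        (MulAction.orbit (↥(Subgroup.zpowers σV)) i) ×ˢ (Set.univ : Set Bool)) ∧
    Nat.card (MulAction.orbitRel.Quotient
        (↥(Subgroup.closure ({tau1perm σV, tau2perm H} : Set (Equiv.Perm (H × Bool)))))
        (H × Bool)) =
      Nat.card (MulAction.orbitRel.Quotient (↥(Subgroup.zpowers σV)) H) ∧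
    (∀ i : H,
      MulAction.orbit
          (↥(Subgroup.closure ({tau0perm σE, tau2perm H} : Set (Equiv.Perm (H × Bool)))))
          ((i, true) : H × Bool) =
        (MulAction.orbit (↥(Subgroup.zpowers σE)) i) ×ˢ (Set.univ : Set Bool)) ∧
    Nat.card (MulAction.orbitRel.Quotient
        (↥(Subgroup.closure ({tau0perm σE, tau2perm H} : Set (Equiv.Perm (H × Bool)))))
        (H × Bool)) =
      Nat.card (MulAction.orbitRel.Quotient (↥(Subgroup.zpowers σE)) H) ∧
    Nat.card (MulAction.orbitRel.Quotient
        (↥(Subgroup.closure ({tau0perm σE, tau1perm σV} : Set (Equiv.Perm (H × Bool)))))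
        (H × Bool)) =
      Nat.card (MulAction.orbitRel.Quotient (↥(Subgroup.zpowers σF)) H) := by
  have hV := doubled_orbits σV (tau1perm σV)
    (by
      rintro ⟨i, _ | _⟩
      · have h := orbitRel_zpowers_apply σV (σV.symm i)
        rw [σV.apply_symm_apply] at h
        exact (MulAction.orbitRel _ H).symm h
      · exact orbitRel_zpowers_apply σV i)
    (fun i => ⟨true, rfl⟩)
  have hE := doubled_orbits σE (tau0perm σE)
    (by
      rintro ⟨i, _ | _⟩
      · exact orbitRel_zpowers_apply σE i
      · have h := orbitRel_zpowers_apply σE (σE.symm i)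
        rw [σE.apply_symm_apply] at h
        exact (MulAction.orbitRel _ H).symm h)
    (fun i => ⟨false, rfl⟩)
  exact ⟨hV.1, hV.2, hE.1, hE.2, card_face_orbits σV σE σF hmodel⟩
end

section
/- Let (σ_V, σ_E, σ_F) be a σ-model on a finite nonempty set H and let (τ_0, τ_1, τ_2) be the associated τ-model on X := H × Bool. Then the subgroup generated by σ_V and σ_E acts transitively on H if and only if the subgroup generated by τ_0, τ_1, τ_2 acts transitively on X. That is, the hypermap is connected in the σ-model exactly when it is connected in the τ-model. -/
/-- If each generator in `S` moves points along `f` within `K`-orbits, then so does every element of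
the subgroup generated by `S`. -/
theorem exists_mem_apply_eq_of_mem_closure {α β : Type*} (f : α → β) {S : Set (Equiv.Perm α)}
    (K : Subgroup (Equiv.Perm β)) (hS : ∀ s ∈ S, ∀ a, ∃ k ∈ K, k (f a) = f (s a))
    {g : Equiv.Perm α} (hg : g ∈ Subgroup.closure S) : ∀ a, ∃ k ∈ K, k (f a) = f (g a) := by
  induction hg using Subgroup.closure_induction with
  | mem s hs => exact hS s hs
  | one => exact fun a => ⟨1, K.one_mem, rfl⟩
  | mul g h _ _ ihg ihh =>
    intro a
    obtain ⟨k, hk, hka⟩ := ihh a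
    obtain ⟨l, hl, hla⟩ := ihg (h a)
    exact ⟨l * k, K.mul_mem hl hk, by rw [Equiv.Perm.mul_apply, hka, hla, Equiv.Perm.mul_apply]⟩
  | inv g _ ih =>
    intro a
    obtain ⟨k, hk, hka⟩ := ih (g⁻¹ a)
    refine ⟨k⁻¹, K.inv_mem hk, ?_⟩
    rw [Equiv.Perm.inv_eq_iff_eq, hka]
    exact congrArg f (g.apply_symm_apply a).symm

/-- A hypermap is connected in the σ-model exactly when it is connected in the associated
τ-model. -/
theorem connected_sigma_iff_tau {H : Type*} [Fintype H] [Nonempty H]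
    (σV σE σF : Equiv.Perm H) (hmodel : σF * σE * σV = 1) :
    (∀ x y : H, ∃ g ∈ Subgroup.closure ({σV, σE} : Set (Equiv.Perm H)), g x = y) ↔
      (∀ p q : H × Bool,
        ∃ g ∈ Subgroup.closure
          ({tau0perm σE, tau1perm σV, tau2perm H} : Set (Equiv.Perm (H × Bool))),
          g p = q) := by
  constructor
  · intro hσ
    set K := Subgroup.closure
      ({tau0perm σE, tau1perm σV, tau2perm H} : Set (Equiv.Perm (H × Bool)))
    have h0 : tau0perm σE ∈ K := Subgroup.subset_closure (by simp)
    have h1 : tau1perm σV ∈ K := Subgroup.subset_closure (by simp)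
    have h2 : tau2perm H ∈ K := Subgroup.subset_closure (by simp)
    have hlift : ∀ x y : H, ∃ k ∈ K, k (x, true) = (y, true) := by
      intro x y
      obtain ⟨g, hg, rfl⟩ := hσ x y
      refine exists_mem_apply_eq_of_mem_closure (fun i : H => (i, true)) K ?_ hg x
      rintro s (rfl | rfl) i
      · exact ⟨tau2perm H * tau1perm s, K.mul_mem h2 h1, rfl⟩
      · exact ⟨tau0perm s * tau2perm H, K.mul_mem h0 h2, rfl⟩
    have hflip : ∀ (x : H) (b : Bool), ∃ k ∈ K, k (x, true) = (x, b) := by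
      rintro x (_ | _)
      · exact ⟨tau2perm H, h2, rfl⟩
      · exact ⟨1, K.one_mem, rfl⟩
    rintro ⟨x, b⟩ ⟨y, c⟩
    obtain ⟨k, hk, hkx⟩ := hflip x b
    obtain ⟨l, hl, hlx⟩ := hlift x y
    obtain ⟨m, hm, hmy⟩ := hflip y c
    refine ⟨m * l * k⁻¹, K.mul_mem (K.mul_mem hm hl) (K.inv_mem hk), ?_⟩
    have hk' : k⁻¹ (x, b) = (x, true) := Equiv.Perm.inv_eq_iff_eq.mpr hkx.symm
    rw [Equiv.Perm.mul_apply, hk', Equiv.Perm.mul_apply, hlx, hmy]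
  · intro hτ x y
    set K := Subgroup.closure ({σV, σE} : Set (Equiv.Perm H))
    have hV : σV ∈ K := Subgroup.subset_closure (by simp)
    have hE : σE ∈ K := Subgroup.subset_closure (by simp)
    obtain ⟨g, hg, hgx⟩ := hτ (x, true) (y, true)
    obtain ⟨k, hk, hkx⟩ : ∃ k ∈ K, k x = (g (x, true)).1 := by
      refine exists_mem_apply_eq_of_mem_closure Prod.fst K ?_ hg (x, true)
      rintro s (rfl | rfl | rfl) ⟨i, _ | _⟩
      · exact ⟨σE, hE, rfl⟩
      · exact ⟨σE⁻¹, K.inv_mem hE, rfl⟩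
      · exact ⟨σV⁻¹, K.inv_mem hV, rfl⟩
      · exact ⟨σV, hV, rfl⟩
      · exact ⟨1, K.one_mem, rfl⟩
      · exact ⟨1, K.one_mem, rfl⟩
    exact ⟨k, hk, by rw [hkx, hgx]⟩
end
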